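/- Let a_1 < a_2 < ... < a_5 be nonnegative integers. (i) If δ_1 < δ_2 > δ_3 < δ_4 and δ_2 < δ_4, then δ(a_2, a_4) = δ_2, so the sequence of δ-values of the 4-tuple (a_1, a_2, a_4, a_5) is δ_1 < δ_2 < δ_4. (ii) If δ_1 > δ_2 < δ_3 > δ_4 and δ_1 > δ_3, then δ(a_2, a_4) = δ_3, so the sequence of δ-values of the 4-tuple (a_1, a_2, a_4, a_5) is δ_1 > δ_3 > δ_4. -/

import Mathlib

/-- For distinct nonnegative integers `a` and `b`, `bdelta a b` is the largest index `i`
such that the `i`-th binary digits of `a` and `b` differ. -/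
noncomputable def bdelta (a b : ℕ) : ℕ := sSup {i | a.testBit i ≠ b.testBit i}

theorem isGreatest_bdelta {a b : ℕ} (h : a ≠ b) :
    IsGreatest {i | a.testBit i ≠ b.testBit i} (bdelta a b) := by
  have hne : {i | a.testBit i ≠ b.testBit i}.Nonempty := Nat.exists_testBit_ne_of_ne h
  have hbdd : BddAbove {i | a.testBit i ≠ b.testBit i} := by
    refine ⟨a + b, fun i hi => ?_⟩
    by_contra! hlt
    have hpow : i < 2 ^ i := Nat.lt_two_pow_self
    apply hi
    rw [Nat.testBit_lt_two_pow (by omega : a < 2 ^ i),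
      Nat.testBit_lt_two_pow (by omega : b < 2 ^ i)]
  exact ⟨Nat.sSup_mem hne hbdd, fun i hi => le_csSup hbdd hi⟩

theorem testBit_eq_of_bdelta_lt {a b i : ℕ} (h : a ≠ b) (hi : bdelta a b < i) :
    a.testBit i = b.testBit i := by
  by_contra hne
  exact absurd ((isGreatest_bdelta h).2 hne) (not_le.mpr hi)

theorem bdelta_comm (a b : ℕ) : bdelta a b = bdelta b a := by
  simp only [bdelta, ne_comm]

theorem bdelta_eq_left_of_lt {a b c : ℕ} (hab : a ≠ b) (hbc : b ≠ c)
    (h : bdelta b c < bdelta a b) : bdelta a c = bdelta a b := by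
  have hgreatest : IsGreatest {i | a.testBit i ≠ c.testBit i} (bdelta a b) := by
    refine ⟨?_, fun i hi => ?_⟩
    · have hmem := (isGreatest_bdelta hab).1
      rwa [Set.mem_ofPred_eq, testBit_eq_of_bdelta_lt hbc h] at hmem
    · by_contra! hlt
      exact hi ((testBit_eq_of_bdelta_lt hab hlt).trans
        (testBit_eq_of_bdelta_lt hbc (h.trans hlt)))
  exact hgreatest.csSup_eq

theorem bdelta_eq_right_of_lt {a b c : ℕ} (hab : a ≠ b) (hbc : b ≠ c)
    (h : bdelta a b < bdelta b c) : bdelta a c = bdelta b c := by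
  rw [bdelta_comm a c, bdelta_comm b c]
  apply bdelta_eq_left_of_lt hbc.symm hab.symm
  rwa [bdelta_comm b a, bdelta_comm c b]

/-- Let `a₁ < ⋯ < a₅` be nonnegative integers (with `δᵢ = δ(aᵢ, aᵢ₊₁)`).
(i) If `δ₁ < δ₂ > δ₃ < δ₄` and `δ₂ < δ₄`, then `δ(a₂, a₄) = δ₂`, so the δ-sequence of the
4-tuple `(a₁, a₂, a₄, a₅)` is `δ₁ < δ₂ < δ₄`.
(ii) If `δ₁ > δ₂ < δ₃ > δ₄` and `δ₁ > δ₃`, then `δ(a₂, a₄) = δ₃`, so the δ-sequence of the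
4-tuple `(a₁, a₂, a₄, a₅)` is `δ₁ > δ₃ > δ₄`. -/
theorem stmt10 (a1 a2 a3 a4 a5 : ℕ)
    (h12 : a1 < a2) (h23 : a2 < a3) (h34 : a3 < a4) (h45 : a4 < a5) :
    ((bdelta a1 a2 < bdelta a2 a3 → bdelta a3 a4 < bdelta a2 a3 →
        bdelta a3 a4 < bdelta a4 a5 → bdelta a2 a3 < bdelta a4 a5 →
      bdelta a2 a4 = bdelta a2 a3 ∧
        (bdelta a1 a2 < bdelta a2 a4 ∧ bdelta a2 a4 < bdelta a4 a5)) ∧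
     (bdelta a2 a3 < bdelta a1 a2 → bdelta a2 a3 < bdelta a3 a4 →
        bdelta a4 a5 < bdelta a3 a4 → bdelta a3 a4 < bdelta a1 a2 →
      bdelta a2 a4 = bdelta a3 a4 ∧
        (bdelta a2 a4 < bdelta a1 a2 ∧ bdelta a4 a5 < bdelta a2 a4))) := by
  refine ⟨fun h1 h2 _ h4 => ?_, fun h1 h2 h3 h4 => ?_⟩
  · have h := bdelta_eq_left_of_lt h23.ne h34.ne h2
    exact ⟨h, h ▸ h1, h ▸ h4⟩
  · have h := bdelta_eq_right_of_lt h23.ne h34.ne h2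
    exact ⟨h, h ▸ h4, h ▸ h3⟩
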